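/- (Berggren's theorem) For every primitive Pythagorean triple v = (a, b, c) there exist a unique finite sequence (d₁, …, d_k) of digits d_i ∈ {1, 2, 3} (possibly empty) and a unique base triple b₀ ∈ {(3, 4, 5), (4, 3, 5)} such that v = M_{d₁}·M_{d₂}·⋯·M_{d_k}·b₀. -/

import Mathlib

/-- The Berggren matrices M₁, M₂, M₃ (indexed by `Fin 3`, so `Mmat 0 = M₁`, etc.). -/
def Mmat : Fin 3 → Matrix (Fin 3) (Fin 3) ℤ :=
  ![!![-1, 2, 2; -2, 1, 2; -2, 2, 3],
    !![1, 2, 2; 2, 1, 2; 2, 2, 3],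
    !![1, -2, 2; 2, -1, 2; 2, -2, 3]]

/-- `(a, b, c)` is a primitive Pythagorean triple. -/
def IsPPT (a b c : ℤ) : Prop :=
  0 < a ∧ 0 < b ∧ 0 < c ∧ Int.gcd (Int.gcd a b) c = 1 ∧ a ^ 2 + b ^ 2 = c ^ 2

lemma Mmat_zero_mulVec (v : Fin 3 → ℤ) :
    (Mmat 0).mulVec v =
      ![-v 0 + 2 * v 1 + 2 * v 2, -2 * v 0 + v 1 + 2 * v 2, -2 * v 0 + 2 * v 1 + 3 * v 2] := by
  ext i
  fin_cases i <;> simp [Mmat, Matrix.mulVec, dotProduct, Fin.sum_univ_three]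

lemma Mmat_one_mulVec (v : Fin 3 → ℤ) :
    (Mmat 1).mulVec v =
      ![v 0 + 2 * v 1 + 2 * v 2, 2 * v 0 + v 1 + 2 * v 2, 2 * v 0 + 2 * v 1 + 3 * v 2] := by
  ext i
  fin_cases i <;> simp [Mmat, Matrix.mulVec, dotProduct, Fin.sum_univ_three]

lemma Mmat_two_mulVec (v : Fin 3 → ℤ) :
    (Mmat 2).mulVec v =
      ![v 0 - 2 * v 1 + 2 * v 2, 2 * v 0 - v 1 + 2 * v 2, 2 * v 0 - 2 * v 1 + 3 * v 2] := by
  ext i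
  fin_cases i <;> simp [Mmat, Matrix.mulVec, dotProduct, Fin.sum_univ_three] <;> ring

/-- The base triple attached to a Boolean. -/
abbrev baseTriple (e : Bool) : Fin 3 → ℤ := if e then ![3, 4, 5] else ![4, 3, 5]

/-- The triple obtained from a base triple by a word in the Berggren matrices. -/
abbrev wordTriple (l : List (Fin 3)) (e : Bool) : Fin 3 → ℤ :=
  ((l.map Mmat).prod).mulVec (baseTriple e)

lemma wordTriple_cons (d : Fin 3) (l : List (Fin 3)) (e : Bool) :
    wordTriple (d :: l) e = (Mmat d).mulVec (wordTriple l e) := by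
  simp [wordTriple, Matrix.mulVec_mulVec]

/-- Every word triple has positive legs, both smaller than the hypotenuse. -/
lemma wordTriple_bounds (l : List (Fin 3)) (e : Bool) :
    0 < wordTriple l e 0 ∧ 0 < wordTriple l e 1 ∧
      wordTriple l e 0 < wordTriple l e 2 ∧ wordTriple l e 1 < wordTriple l e 2 := by
  induction l with
  | nil => cases e <;> simp [wordTriple, baseTriple]
  | cons d l ih =>
    rw [wordTriple_cons]
    generalize wordTriple l e = v at ih
    fin_cases d <;>
      simp only [Fin.zero_eta, Fin.mk_one, Fin.reduceFinMk, Mmat_zero_mulVec, Mmat_one_mulVec,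
        Mmat_two_mulVec, Matrix.cons_val] <;> omega

lemma baseTriple_injective : Function.Injective baseTriple := by
  intro e e' h
  have h0 := congrFun h 0
  cases e <;> cases e' <;> simp [baseTriple] at h0 ⊢

lemma baseTriple_ne_mulVec (e : Bool) (d : Fin 3) (v : Fin 3 → ℤ) (h0 : 0 < v 0) (h1 : 0 < v 1) :
    baseTriple e ≠ (Mmat d).mulVec v := by
  intro h
  have e0 := congrFun h 0
  have e1 := congrFun h 1
  have e2 := congrFun h 2
  cases e <;> fin_cases d <;>
    simp [baseTriple, Mmat_zero_mulVec, Mmat_one_mulVec, Mmat_two_mulVec] at e0 e1 e2 <;> omega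

lemma Mmat_mulVec_injective {d d' : Fin 3} {v w : Fin 3 → ℤ} (hv0 : 0 < v 0) (hv1 : 0 < v 1)
    (hw0 : 0 < w 0) (hw1 : 0 < w 1) (h : (Mmat d).mulVec v = (Mmat d').mulVec w) :
    d = d' ∧ v = w := by
  have e0 := congrFun h 0
  have e1 := congrFun h 1
  have e2 := congrFun h 2
  rw [funext_iff, Fin.forall_fin_succ, Fin.forall_fin_two]
  fin_cases d <;> fin_cases d' <;>
    simp [Mmat_zero_mulVec, Mmat_one_mulVec, Mmat_two_mulVec] at e0 e1 e2 ⊢ <;> omega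

lemma wordTriple_injective {l l' : List (Fin 3)} {e e' : Bool}
    (h : wordTriple l e = wordTriple l' e') : l = l' ∧ e = e' := by
  induction l generalizing l' with
  | nil =>
    cases l' with
    | nil => exact ⟨rfl, baseTriple_injective (by simpa [wordTriple] using h)⟩
    | cons d' l' =>
      obtain ⟨h0, h1, -⟩ := wordTriple_bounds l' e'
      rw [wordTriple_cons] at h
      exact absurd (by simpa [wordTriple] using h) (baseTriple_ne_mulVec e d' _ h0 h1)
  | cons d l ih =>
    obtain ⟨h0, h1, -⟩ := wordTriple_bounds l e
    cases l' with
    | nil =>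
      rw [wordTriple_cons] at h
      exact absurd (by simpa [wordTriple] using h.symm) (baseTriple_ne_mulVec e' d _ h0 h1)
    | cons d' l' =>
      obtain ⟨h0', h1', -⟩ := wordTriple_bounds l' e'
      rw [wordTriple_cons, wordTriple_cons] at h
      obtain ⟨rfl, hl⟩ := Mmat_mulVec_injective h0 h1 h0' h1' h
      obtain ⟨rfl, rfl⟩ := ih hl
      exact ⟨rfl, rfl⟩

lemma gcd_gcd_eq_one_iff (a b c : ℤ) :
    Int.gcd (Int.gcd a b) c = 1 ↔ ∀ k : ℤ, k ∣ a → k ∣ b → k ∣ c → IsUnit k := by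
  constructor
  · intro h k ha hb hc
    have := Int.dvd_coe_gcd (Int.dvd_coe_gcd ha hb) hc
    rw [h] at this
    exact isUnit_of_dvd_one (by simpa using this)
  · intro h
    have hab : (Int.gcd (Int.gcd a b) c : ℤ) ∣ Int.gcd a b := Int.gcd_dvd_left ..
    have := h _ (hab.trans (Int.gcd_dvd_left ..)) (hab.trans (Int.gcd_dvd_right ..))
      (Int.gcd_dvd_right ..)
    simpa [Int.isUnit_iff_natAbs_eq] using this

/-- A primitive triple whose legs are in ratio `4 : 3` is `(4, 3, 5)`. -/
lemma IsPPT.eq_four_three_five {a b c : ℤ} (h : IsPPT a b c) (hab : 4 * b = 3 * a) :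
    a = 4 ∧ b = 3 ∧ c = 5 := by
  obtain ⟨ha, hb, hc, hg, hp⟩ := h
  obtain ⟨k, rfl⟩ : (4 : ℤ) ∣ a := by omega
  obtain rfl : b = 3 * k := by omega
  have hk : 0 < k := by omega
  obtain rfl : c = 5 * k := by nlinarith
  have := (gcd_gcd_eq_one_iff _ _ _).1 hg k (by simp) (by simp) (by simp)
  rcases Int.isUnit_iff.1 this with rfl | rfl <;> simp_all

lemma IsPPT.swap {a b c : ℤ} (h : IsPPT a b c) : IsPPT b a c := by
  obtain ⟨ha, hb, hc, hg, hp⟩ := h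
  exact ⟨hb, ha, hc, by rwa [Int.gcd_comm b a], by rw [add_comm, hp]⟩

/-- The triple `M₂⁻¹ (a, b, c)` is primitive Pythagorean once the signs of its legs are made
positive. -/
lemma IsPPT.parent {a b c x y : ℤ} (h : IsPPT a b c) (hx : 0 < x) (hy : 0 < y)
    (hxa : x = a + 2 * b - 2 * c ∨ x = -(a + 2 * b - 2 * c))
    (hyb : y = 2 * a + b - 2 * c ∨ y = -(2 * a + b - 2 * c)) :
    IsPPT x y (3 * c - 2 * a - 2 * b) := by
  obtain ⟨ha, hb, hc, hg, hp⟩ := h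
  refine ⟨hx, hy, by nlinarith [sq_nonneg (a - b)], ?_, ?_⟩
  · rw [gcd_gcd_eq_one_iff] at hg ⊢
    intro k h0 h1 h2
    have h0' : k ∣ a + 2 * b - 2 * c := by
      rcases hxa with rfl | rfl
      exacts [h0, dvd_neg.1 h0]
    have h1' : k ∣ 2 * a + b - 2 * c := by
      rcases hyb with rfl | rfl
      exacts [h1, dvd_neg.1 h1]
    obtain ⟨r, hr⟩ := h0'
    obtain ⟨s, hs⟩ := h1'
    obtain ⟨t, ht⟩ := h2
    exact hg k ⟨r + 2 * s + 2 * t, by linear_combination hr + 2 * hs + 2 * ht⟩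
      ⟨2 * r + s + 2 * t, by linear_combination 2 * hr + hs + 2 * ht⟩
      ⟨2 * r + 2 * s + 3 * t, by linear_combination 2 * hr + 2 * hs + 3 * ht⟩
  · rcases hxa with rfl | rfl <;> rcases hyb with rfl | rfl <;> linear_combination hp

lemma IsPPT.two_mul_lt_iff {a b c : ℤ} (h : IsPPT a b c) :
    2 * c < a + 2 * b ↔ 3 * a < 4 * b := by
  obtain ⟨ha, hb, hc, -, hp⟩ := h
  constructor <;> intro h <;> by_contra! <;> nlinarith

lemma IsPPT.lt_two_mul_iff {a b c : ℤ} (h : IsPPT a b c) :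
    a + 2 * b < 2 * c ↔ 4 * b < 3 * a := by
  obtain ⟨ha, hb, hc, -, hp⟩ := h
  constructor <;> intro h <;> by_contra! <;> nlinarith

lemma IsPPT.exists_wordTriple {a b c : ℤ} (h : IsPPT a b c) :
    ∃ l e, ![a, b, c] = wordTriple l e := by
  induction hn : c.toNat using Nat.strong_induction_on generalizing a b c with
  | _ n ih =>
  obtain ⟨ha, hb, hc, -, hp⟩ := id h
  have hlt : c < a + b := by nlinarith
  have step (d : Fin 3) {x y : ℤ} (hxy : IsPPT x y (3 * c - 2 * a - 2 * b))
      (hd : ![a, b, c] = (Mmat d).mulVec ![x, y, 3 * c - 2 * a - 2 * b]) :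
      ∃ l e, ![a, b, c] = wordTriple l e := by
    obtain ⟨l, e, hl⟩ := ih _ (by omega) hxy rfl
    exact ⟨d :: l, e, by rw [wordTriple_cons, ← hl, hd]⟩
  have hx := h.two_mul_lt_iff
  have hx' := h.lt_two_mul_iff
  have hy := h.swap.two_mul_lt_iff
  have hy' := h.swap.lt_two_mul_iff
  rcases lt_trichotomy (4 * b) (3 * a) with hba | hba | hba
  · refine step 0 (x := -(a + 2 * b - 2 * c)) (y := 2 * a + b - 2 * c)
      (h.parent (by omega) (by omega) (.inr rfl) (.inl rfl)) ?_
    rw [Mmat_zero_mulVec]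
    simp
    ring_nf
    simp
  · obtain ⟨rfl, rfl, rfl⟩ := h.eq_four_three_five hba
    exact ⟨[], false, by simp [wordTriple, baseTriple]⟩
  rcases lt_trichotomy (4 * a) (3 * b) with hab | hab | hab
  · refine step 2 (x := a + 2 * b - 2 * c) (y := -(2 * a + b - 2 * c))
      (h.parent (by omega) (by omega) (.inl rfl) (.inr rfl)) ?_
    rw [Mmat_two_mulVec]
    simp
    ring_nf
    simp
  · obtain ⟨rfl, rfl, rfl⟩ := h.swap.eq_four_three_five hab
    exact ⟨[], true, by simp [wordTriple, baseTriple]⟩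
  · refine step 1 (x := a + 2 * b - 2 * c) (y := 2 * a + b - 2 * c)
      (h.parent (by omega) (by omega) (.inl rfl) (.inl rfl)) ?_
    rw [Mmat_one_mulVec]
    simp
    ring_nf
    simp

/-- Berggren's theorem: every primitive Pythagorean triple is obtained from exactly
one of the base triples (3,4,5), (4,3,5) by a unique finite word in M₁, M₂, M₃. -/
theorem stmt_6 (a b c : ℤ) (h : IsPPT a b c) :
    ∃! p : List (Fin 3) × Bool,
      ![a, b, c] =
        ((p.1.map Mmat).prod).mulVec (if p.2 then ![3, 4, 5] else ![4, 3, 5]) := by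
  obtain ⟨l, e, hl⟩ := h.exists_wordTriple
  refine ⟨(l, e), hl, fun p hp => ?_⟩
  obtain ⟨h1, h2⟩ := wordTriple_injective (hp.symm.trans hl)
  exact Prod.ext h1 h2
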